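/- Let ω = e^{2πi/3}. In ℂ² ⊗ ℂ² ⊗ ℂ², the three vectors |φ₀⟩ = |000⟩ − |111⟩, |φ₁⟩ = |100⟩ + ω|010⟩ + ω²|001⟩, and |S⟩ = (|0⟩+|1⟩)^{⊗3} are pairwise orthogonal, and for each party k ∈ {1,2,3}, any 2×2 complex matrix E satisfying ⟨ψ| E^{(k)} |φ⟩ = 0 for all distinct pairs ψ, φ from {|φ₀⟩, |φ₁⟩, |S⟩} must be a scalar multiple of the identity. -/

import Mathlib

open Finset

/-- The `d+1` states of Theorem 3 in `(ℂ^d)^{⊗n}` (Eq. (6)), as coefficient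
functions on multi-indices. Index `0` is `|0⟩^{⊗n} − |1⟩^{⊗n}`; index `i` with
`1 ≤ i ≤ d−1` is `∑_{k<n} ω^k |0⟩^{⊗k}⊗|i⟩⊗|0⟩^{⊗(n−1−k)}` where
`ω = exp(2πi/n)`; index `d` is the stopper `(∑_a |a⟩)^{⊗n}`. -/
noncomputable def stateN (d n : ℕ) (i : ℕ) : (Fin n → Fin d) → ℂ :=
  if i = 0 then
    fun x => (if ∀ l, (x l : ℕ) = 0 then 1 else 0) - (if ∀ l, (x l : ℕ) = 1 then 1 else 0)
  else if i < d then
    fun x => ∑ k : Fin n, (Complex.exp (2 * Real.pi * Complex.I / n)) ^ (k : ℕ) *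
      (if ∀ l, (x l : ℕ) = (if l = k then i else 0) then 1 else 0)
  else fun _ => 1

theorem sum_fin_three_fun {α M : Type*} [Fintype α] [AddCommMonoid M] (f : (Fin 3 → α) → M) :
    ∑ x, f x = ∑ a, ∑ b, ∑ c, f ![a, b, c] := by
  let e : (Fin 3 → α) ≃ (α × α) × α :=
    { toFun := fun x => ((x 0, x 1), x 2)
      invFun := fun p => ![p.1.1, p.1.2, p.2]
      left_inv := fun x => by ext i; fin_cases i <;> rfl
      right_inv := fun _ => rfl }
  rw [← e.symm.sum_comp f, Fintype.sum_prod_type, Fintype.sum_prod_type]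
  rfl

theorem stateN_two_three_zero (a b c : Fin 2) :
    stateN 2 3 0 ![a, b, c] =
      (if a = 0 ∧ b = 0 ∧ c = 0 then 1 else 0) - (if a = 1 ∧ b = 1 ∧ c = 1 then 1 else 0) := by
  fin_cases a <;> fin_cases b <;> fin_cases c <;> simp [stateN, Fin.forall_fin_succ]

theorem stateN_two_three_one (a b c : Fin 2) :
    stateN 2 3 1 ![a, b, c] =
      (if a = 1 ∧ b = 0 ∧ c = 0 then 1 else 0) +
      Complex.exp (2 * Real.pi * Complex.I / 3) * (if a = 0 ∧ b = 1 ∧ c = 0 then 1 else 0) +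
      Complex.exp (2 * Real.pi * Complex.I / 3) ^ 2 * (if a = 0 ∧ b = 0 ∧ c = 1 then 1 else 0) := by
  fin_cases a <;> fin_cases b <;> fin_cases c <;>
    simp [stateN, Fin.sum_univ_three, Fin.forall_fin_succ]

theorem stateN_two_three_two (x : Fin 3 → Fin 2) : stateN 2 3 2 x = 1 := rfl

theorem one_add_exp_add_exp_sq :
    1 + Complex.exp (2 * Real.pi * Complex.I / 3) +
      Complex.exp (2 * Real.pi * Complex.I / 3) ^ 2 = 0 := by
  have h := (Complex.isPrimitiveRoot_exp 3 (by norm_num)).geom_sum_eq_zero (by norm_num)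
  simpa [Finset.sum_range_succ] using h

theorem update_fin_three_zero {α : Type*} (a b c d : α) :
    Function.update ![a, b, c] 0 d = ![d, b, c] := by
  ext i; fin_cases i <;> rfl

theorem update_fin_three_one {α : Type*} (a b c d : α) :
    Function.update ![a, b, c] 1 d = ![a, d, c] := by
  ext i; fin_cases i <;> rfl

theorem update_fin_three_two {α : Type*} (a b c d : α) :
    Function.update ![a, b, c] 2 d = ![a, b, d] := by
  ext i; fin_cases i <;> rfl

theorem sum_conj_mul_stateN_two_three {i j : ℕ} (hi : i ≤ 2) (hj : j ≤ 2) (hij : i ≠ j) :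
    ∑ x : Fin 3 → Fin 2, (starRingEnd ℂ) (stateN 2 3 i x) * stateN 2 3 j x = 0 := by
  have hω := one_add_exp_add_exp_sq
  have hω' := congrArg (starRingEnd ℂ) hω
  simp only [map_add, map_one, map_pow, map_zero] at hω'
  simp only [sum_fin_three_fun, Fin.sum_univ_two]
  generalize hw : Complex.exp (2 * Real.pi * Complex.I / 3) = ω at *
  interval_cases i <;> interval_cases j <;>
    simp [stateN_two_three_zero, stateN_two_three_one, stateN_two_three_two, hw] at hij ⊢
  · linear_combination hω'
  · linear_combination hω

theorem entries_of_preserves_orthogonality (k : Fin 3) (E : Matrix (Fin 2) (Fin 2) ℂ)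
    (h : ∀ i j : ℕ, i ≤ 2 → j ≤ 2 → i ≠ j →
      ∑ x : Fin 3 → Fin 2, (starRingEnd ℂ) (stateN 2 3 i x) *
        (∑ b : Fin 2, E (x k) b * stateN 2 3 j (Function.update x k b)) = 0) :
    E 0 1 = 0 ∧ E 1 0 = 0 ∧ E 0 0 = E 1 1 := by
  have h₀₁ := h 0 1 (by norm_num) (by norm_num) (by norm_num)
  have h₁₀ := h 1 0 (by norm_num) (by norm_num) (by norm_num)
  have h₀₂ := h 0 2 (by norm_num) (by norm_num) (by norm_num)
  rw [sum_fin_three_fun] at h₀₁ h₁₀ h₀₂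
  have e₀₁ : E 0 1 = 0 := by
    fin_cases k <;>
    simpa [Fin.sum_univ_two, update_fin_three_zero, update_fin_three_one, update_fin_three_two,
      stateN_two_three_zero, stateN_two_three_one] using h₀₁
  have e₁₀ : E 1 0 = 0 := by
    fin_cases k <;>
    simpa [Fin.sum_univ_two, update_fin_three_zero, update_fin_three_one, update_fin_three_two,
      stateN_two_three_zero, stateN_two_three_one] using h₁₀
  refine ⟨e₀₁, e₁₀, ?_⟩
  fin_cases k <;>
    simp [Fin.sum_univ_two, stateN_two_three_zero, stateN_two_three_two, e₀₁, e₁₀] at h₀₂ <;>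
    linear_combination h₀₂

theorem three_qubit_locally_stable :
    (∀ i j : ℕ, i ≤ 2 → j ≤ 2 → i ≠ j →
      ∑ x : Fin 3 → Fin 2, (starRingEnd ℂ) (stateN 2 3 i x) * stateN 2 3 j x = 0) ∧
    (∀ k : Fin 3, ∀ E : Matrix (Fin 2) (Fin 2) ℂ,
      (∀ i j : ℕ, i ≤ 2 → j ≤ 2 → i ≠ j →
        ∑ x : Fin 3 → Fin 2, (starRingEnd ℂ) (stateN 2 3 i x) *
          (∑ b : Fin 2, E (x k) b * stateN 2 3 j (Function.update x k b)) = 0) →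
      ∃ c : ℂ, E = c • (1 : Matrix (Fin 2) (Fin 2) ℂ)) := by
  refine ⟨fun i j hi hj hij => sum_conj_mul_stateN_two_three hi hj hij, fun k E h => ?_⟩
  obtain ⟨h₀₁, h₁₀, hdiag⟩ := entries_of_preserves_orthogonality k E h
  refine ⟨E 0 0, ?_⟩
  ext a b
  fin_cases a <;> fin_cases b <;> simp [h₀₁, h₁₀, hdiag]
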